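/- arXiv:1701.06084 — 2 statements merged into one kernel-verified Lean document; each statement's English description precedes it below -/
import Mathlib

section
/- (Positivity of the exponent α4) Let Y be a finite alphabet and let π and μ be distinct pmfs on Y with full support. Then the infimum, over triples of pmfs (q1, q2, q3) on Y satisfying D(q1‖q2) > D(q3‖q2), of D(q1‖μ) + D(q2‖μ) + D(q3‖π), is strictly positive. -/
open scoped BigOperators

/-- A probability mass function on a finite alphabet `Y`. -/
def IsPmf {Y : Type*} [Fintype Y] (p : Y → ℝ) : Prop :=
  (∀ y, 0 ≤ p y) ∧ ∑ y, p y = 1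

/-- KL divergence `D(p‖q)`, valued in the extended reals: it is `+∞` when the
support of `p` is not contained in that of `q`. -/
noncomputable def KL {Y : Type*} [Fintype Y] (p q : Y → ℝ) : EReal :=
  if ∀ y, q y = 0 → p y = 0 then ((∑ y, p y * Real.log (p y / q y) : ℝ) : EReal) else ⊤

/-- Bhattacharyya distance `B(p,q) = −log( Σ_y √(p y) √(q y) )`. -/
noncomputable def Bhat {Y : Type*} [Fintype Y] (p q : Y → ℝ) : ℝ :=
  - Real.log (∑ y, Real.sqrt (p y) * Real.sqrt (q y))

/-- Pointwise form of the bound of the KL divergence by the squared Hellinger distance. -/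
theorem sub_add_sq_sqrt_sub_sqrt_le_mul_log {x y : ℝ} (hx : 0 ≤ x) (hy : 0 < y) :
    x - y + (√x - √y) ^ 2 ≤ x * Real.log (x / y) := by
  rcases hx.eq_or_lt with rfl | hx
  · simp [Real.sq_sqrt hy.le]
  · have hsx := Real.sqrt_pos.2 hx
    have hsy := Real.sqrt_pos.2 hy
    have hlog : Real.log (x / y) = -2 * Real.log (√y / √x) := by
      rw [Real.log_div hx.ne' hy.ne', Real.log_div hsy.ne' hsx.ne', Real.log_sqrt hx.le,
        Real.log_sqrt hy.le]
      ring
    have hle := mul_le_mul_of_nonneg_left (Real.log_le_sub_one_of_pos (div_pos hsy hsx)) hx.le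
    have hmul : x * (√y / √x) = √x * √y := by
      rw [mul_div_left_comm, Real.div_sqrt, mul_comm]
    rw [hlog]
    nlinarith [Real.sq_sqrt hx.le, Real.sq_sqrt hy.le]

theorem sub_add_sq_sub_div_four_le_mul_log {x y : ℝ} (hx : 0 ≤ x) (hx1 : x ≤ 1) (hy : 0 < y)
    (hy1 : y ≤ 1) : x - y + (x - y) ^ 2 / 4 ≤ x * Real.log (x / y) := by
  refine le_trans ?_ (sub_add_sq_sqrt_sub_sqrt_le_mul_log hx hy)
  have hfac : (x - y) ^ 2 = (√x - √y) ^ 2 * (√x + √y) ^ 2 := by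
    rw [← mul_pow]
    congr 1
    linarith [Real.sq_sqrt hx, Real.sq_sqrt hy.le]
  have hsum : (√x + √y) ^ 2 ≤ 2 ^ 2 :=
    pow_le_pow_left₀ (by positivity) (by linarith [Real.sqrt_le_one.2 hx1, Real.sqrt_le_one.2 hy1]) 2
  nlinarith [mul_le_mul_of_nonneg_left hsum (sq_nonneg (√x - √y))]

theorem IsPmf.le_one {Y : Type*} [Fintype Y] {p : Y → ℝ} (hp : IsPmf p) (y : Y) : p y ≤ 1 :=
  hp.2 ▸ Finset.single_le_sum (fun z _ => hp.1 z) (Finset.mem_univ y)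

/-- A Pinsker-type inequality for the sup distance. -/
theorem IsPmf.sq_dist_div_four_le {Y : Type*} [Fintype Y] {p q : Y → ℝ}
    (hp : IsPmf p) (hq : IsPmf q) (hq0 : ∀ y, 0 < q y) :
    dist p q ^ 2 / 4 ≤ ∑ y, p y * Real.log (p y / q y) := by
  have hsum : ∑ y, (p y - q y) ^ 2 ≤ 4 * ∑ y, p y * Real.log (p y / q y) := by
    have h := Finset.sum_le_sum fun y (_ : y ∈ Finset.univ) =>
      sub_add_sq_sub_div_four_le_mul_log (hp.1 y) (hp.le_one y) (hq0 y) (hq.le_one y)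
    rw [Finset.sum_add_distrib, Finset.sum_sub_distrib, hp.2, hq.2, ← Finset.sum_div] at h
    linarith
  have hdist : dist p q ≤ √(∑ y, (p y - q y) ^ 2) := by
    refine (dist_pi_le_iff (Real.sqrt_nonneg _)).2 fun y => Real.le_sqrt_of_sq_le ?_
    rw [Real.dist_eq, sq_abs]
    exact Finset.single_le_sum (f := fun y => (p y - q y) ^ 2) (fun z _ => sq_nonneg _)
      (Finset.mem_univ y)
  have hsq := pow_le_pow_left₀ dist_nonneg hdist 2
  rw [Real.sq_sqrt (Finset.sum_nonneg fun y _ => sq_nonneg _)] at hsq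
  linarith

theorem KL_of_pos {Y : Type*} [Fintype Y] (p : Y → ℝ) {q : Y → ℝ} (hq : ∀ y, 0 < q y) :
    KL p q = ((∑ y, p y * Real.log (p y / q y) : ℝ) : EReal) :=
  if_pos fun y hy => absurd hy (hq y).ne'

/-- The divergence is jointly continuous at pairs of strictly positive functions. -/
theorem continuousAt_sum_mul_log_div {Y : Type*} [Fintype Y] {p q : Y → ℝ}
    (hp : ∀ y, 0 < p y) (hq : ∀ y, 0 < q y) :
    ContinuousAt (fun z : (Y → ℝ) × (Y → ℝ) => ∑ y, z.1 y * Real.log (z.1 y / z.2 y)) (p, q) := by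
  refine tendsto_finsetSum _ fun y _ => ?_
  have h1 : ContinuousAt (fun z : (Y → ℝ) × (Y → ℝ) => z.1 y) (p, q) := by fun_prop
  have h2 : ContinuousAt (fun z : (Y → ℝ) × (Y → ℝ) => z.2 y) (p, q) := by fun_prop
  exact h1.mul ((h1.div h2 (hq y).ne').log (div_pos (hp y) (hq y)).ne')

/-- positivity of the exponent α4. For distinct full-support
pmfs `π` and `μ`, the infimum over pmf triples `(q1,q2,q3)` satisfying
`D(q1‖q2) > D(q3‖q2)` of `D(q1‖μ) + D(q2‖μ) + D(q3‖π)` is strictly positive. -/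
theorem alpha4_pos {Y : Type*} [Fintype Y] [Nonempty Y]
    (π μ : Y → ℝ) (hπ : IsPmf π) (hμ : IsPmf μ)
    (hπf : ∀ y, 0 < π y) (hμf : ∀ y, 0 < μ y) (hne : π ≠ μ) :
    0 < sInf {r : EReal | ∃ q1 q2 q3 : Y → ℝ,
      IsPmf q1 ∧ IsPmf q2 ∧ IsPmf q3 ∧
      KL q3 q2 < KL q1 q2 ∧
      r = KL q1 μ + KL q2 μ + KL q3 π} := by
  have hev : ∀ᶠ z : (Y → ℝ) × (Y → ℝ) × (Y → ℝ) in nhds (μ, μ, π),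
      (∀ y, 0 < z.2.1 y) ∧ ∑ y, z.1 y * Real.log (z.1 y / z.2.1 y) <
        ∑ y, z.2.2 y * Real.log (z.2.2 y / z.2.1 y) := by
    refine Filter.Eventually.and (Filter.eventually_all.2 fun y => ?_) ?_
    · have h : ContinuousAt (fun z : (Y → ℝ) × (Y → ℝ) × (Y → ℝ) => z.2.1 y) (μ, μ, π) := by
        fun_prop
      exact h.eventually (lt_mem_nhds (hμf y))
    · have h1 := (continuousAt_sum_mul_log_div hμf hμf).comp_of_eq
        (f := fun z : (Y → ℝ) × (Y → ℝ) × (Y → ℝ) => (z.1, z.2.1)) (x := (μ, μ, π))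
        (by fun_prop) rfl
      have h2 := (continuousAt_sum_mul_log_div hπf hμf).comp_of_eq
        (f := fun z : (Y → ℝ) × (Y → ℝ) × (Y → ℝ) => (z.2.2, z.2.1)) (x := (μ, μ, π))
        (by fun_prop) rfl
      refine Filter.Tendsto.eventually_lt h1 h2 ?_
      have hpos := hπ.sq_dist_div_four_le hμ hμf
      have hd := dist_pos.2 hne
      have hzero : ∑ y, μ y * Real.log (μ y / μ y) = 0 :=
        Finset.sum_eq_zero fun y _ => by simp [(hμf y).ne']
      simp only [Function.comp_apply]
      rw [hzero]
      exact lt_of_lt_of_le (by positivity) hpos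
  obtain ⟨ε, hε, hball⟩ := Metric.eventually_nhds_iff.1 hev
  refine lt_of_lt_of_le (b := ((ε ^ 2 / 4 : ℝ) : EReal))
    (EReal.coe_pos.2 (by positivity)) (le_sInf ?_)
  rintro r ⟨q1, q2, q3, h1, h2, h3, hlt, rfl⟩
  have hfar : ε ≤ dist (q1, q2, q3) (μ, μ, π) := by
    by_contra! hclose
    obtain ⟨hpos, hlt'⟩ := hball hclose
    rw [KL_of_pos q3 hpos, KL_of_pos q1 hpos, EReal.coe_lt_coe_iff] at hlt
    exact lt_asymm hlt hlt'
  rw [KL_of_pos q1 hμf, KL_of_pos q2 hμf, KL_of_pos q3 hπf, ← EReal.coe_add, ← EReal.coe_add,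
    EReal.coe_le_coe_iff]
  have d1 := h1.sq_dist_div_four_le hμ hμf
  have d2 := h2.sq_dist_div_four_le hμ hμf
  have d3 := h3.sq_dist_div_four_le hπ hπf
  rw [Prod.dist_eq, Prod.dist_eq] at hfar
  rcases le_max_iff.1 hfar with h | h
  · nlinarith [pow_le_pow_left₀ hε.le h 2, sq_nonneg (dist q2 μ), sq_nonneg (dist q3 π)]
  rcases le_max_iff.1 h with h | h
  · nlinarith [pow_le_pow_left₀ hε.le h 2, sq_nonneg (dist q1 μ), sq_nonneg (dist q3 π)]
  · nlinarith [pow_le_pow_left₀ hε.le h 2, sq_nonneg (dist q1 μ), sq_nonneg (dist q2 μ)]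
end

section
/- (Positivity of the exponent α8 under the clustering condition) Let Y be a finite alphabet, let S and T be nonempty finite index sets, and let μ_i (i ∈ S) and π_j (j ∈ T) be pmfs on Y with full support satisfying the clustering condition: max_{i,i'∈S} D(μ_i‖μ_{i'}) < min_{i∈S, j∈T} min{ D(μ_i‖π_j), D(π_j‖μ_i) } and max_{j,j'∈T} D(π_j‖π_{j'}) < min_{i∈S, j∈T} min{ D(μ_i‖π_j), D(π_j‖μ_i) }. Then the infimum, over i1, i2 ∈ S, j ∈ T, and triples of pmfs (q1, q2, q3) on Y satisfying D(q1‖q2) > D(q3‖q2), of D(q1‖μ_{i1}) + D(q2‖μ_{i2}) + D(q3‖π_j), is strictly positive. -/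
open scoped BigOperators

open Filter Topology

/-- The real-valued sum underlying the KL divergence. -/
noncomputable def klSum {Y : Type*} [Fintype Y] (p q : Y → ℝ) : ℝ :=
  ∑ y, p y * Real.log (p y / q y)

section

variable {Y : Type*} [Fintype Y]

lemma KL_eq_klSum {p q : Y → ℝ} (hq : ∀ y, 0 < q y) : KL p q = (klSum p q : EReal) := by
  rw [KL, if_pos fun y hy => absurd hy (hq y).ne']
  rfl

lemma klSum_eq_sum_klFun {p q : Y → ℝ} (hp : IsPmf p) (hq : IsPmf q) (hq0 : ∀ y, 0 < q y) :
    klSum p q = ∑ y, q y * InformationTheory.klFun (p y / q y) := by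
  have key : ∀ y, q y * InformationTheory.klFun (p y / q y) =
      p y * Real.log (p y / q y) + (q y - p y) := by
    intro y
    have := (hq0 y).ne'
    rw [InformationTheory.klFun]
    field_simp
    ring
  simp only [key, Finset.sum_add_distrib, Finset.sum_sub_distrib, hp.2, hq.2, klSum]
  ring

lemma mul_klFun_nonneg {p q : ℝ} (hp : 0 ≤ p) (hq : 0 < q) :
    0 ≤ q * InformationTheory.klFun (p / q) :=
  mul_nonneg hq.le (InformationTheory.klFun_nonneg (div_nonneg hp hq.le))

lemma klSum_nonneg {p q : Y → ℝ} (hp : IsPmf p) (hq : IsPmf q) (hq0 : ∀ y, 0 < q y) :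
    0 ≤ klSum p q := by
  rw [klSum_eq_sum_klFun hp hq hq0]
  exact Finset.sum_nonneg fun y _ => mul_klFun_nonneg (hp.1 y) (hq0 y)

lemma eq_of_klSum_eq_zero {p q : Y → ℝ} (hp : IsPmf p) (hq : IsPmf q) (hq0 : ∀ y, 0 < q y)
    (h : klSum p q = 0) : p = q := by
  rw [klSum_eq_sum_klFun hp hq hq0, Finset.sum_eq_zero_iff_of_nonneg
    fun y _ => mul_klFun_nonneg (hp.1 y) (hq0 y)] at h
  ext y
  have hy := (mul_eq_zero.1 (h y (Finset.mem_univ y))).resolve_left (hq0 y).ne'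
  rw [InformationTheory.klFun_eq_zero_iff (div_nonneg (hp.1 y) (hq0 y).le)] at hy
  exact (div_eq_one_iff_eq (hq0 y).ne').1 hy

lemma continuous_klSum_left {q : Y → ℝ} (hq0 : ∀ y, 0 < q y) :
    Continuous fun p : Y → ℝ => klSum p q := by
  refine continuous_finsetSum _ fun y _ => ?_
  have h : Continuous fun p : Y → ℝ => q y * (p y / q y * Real.log (p y / q y)) :=
    continuous_const.mul (Real.continuous_mul_log.comp ((continuous_apply y).div_const _))
  refine h.congr fun p => ?_
  have := (hq0 y).ne'
  field_simp

lemma ContinuousAt.klSum {X : Type*} [TopologicalSpace X] {f g : X → Y → ℝ} {x : X}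
    (hf : ContinuousAt f x) (hg : ContinuousAt g x) (hf0 : ∀ y, 0 < f x y)
    (hg0 : ∀ y, 0 < g x y) : ContinuousAt (fun z => klSum (f z) (g z)) x := by
  refine tendsto_finsetSum _ fun y _ => ?_
  have hfy : ContinuousAt (fun z => f z y) x := continuousAt_pi.1 hf y
  have hgy : ContinuousAt (fun z => g z y) x := continuousAt_pi.1 hg y
  exact hfy.mul ((hfy.div hgy (hg0 y).ne').log (div_pos (hf0 y) (hg0 y)).ne')

lemma isCompact_setOf_isPmf : IsCompact {p : Y → ℝ | IsPmf p} :=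
  isCompact_stdSimplex ℝ Y

/-- Away from any neighbourhood of `(m₁, m₂, m₃)`, the sum of the divergences to the `mᵢ` is
bounded below by a positive constant. -/
lemma exists_pos_le_klSum_add {m₁ m₂ m₃ : Y → ℝ}
    (h₁ : IsPmf m₁) (h₂ : IsPmf m₂) (h₃ : IsPmf m₃)
    (h₁0 : ∀ y, 0 < m₁ y) (h₂0 : ∀ y, 0 < m₂ y) (h₃0 : ∀ y, 0 < m₃ y)
    {U : Set ((Y → ℝ) × (Y → ℝ) × (Y → ℝ))} (hU : U ∈ 𝓝 (m₁, m₂, m₃)) :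
    ∃ c : ℝ, 0 < c ∧ ∀ q₁ q₂ q₃ : Y → ℝ, IsPmf q₁ → IsPmf q₂ → IsPmf q₃ →
      (q₁, q₂, q₃) ∉ U → c ≤ klSum q₁ m₁ + klSum q₂ m₂ + klSum q₃ m₃ := by
  obtain ⟨V, hVU, hVo, hmV⟩ := mem_nhds_iff.1 hU
  let K : Set ((Y → ℝ) × (Y → ℝ) × (Y → ℝ)) :=
    {p | IsPmf p} ×ˢ {p | IsPmf p} ×ˢ {p | IsPmf p}
  have hK : IsCompact (K \ V) :=
    (isCompact_setOf_isPmf.prod (isCompact_setOf_isPmf.prod isCompact_setOf_isPmf)).diff hVo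
  let F : (Y → ℝ) × (Y → ℝ) × (Y → ℝ) → ℝ := fun q =>
    klSum q.1 m₁ + klSum q.2.1 m₂ + klSum q.2.2 m₃
  have hF : Continuous F :=
    (((continuous_klSum_left h₁0).comp continuous_fst).add
      ((continuous_klSum_left h₂0).comp (continuous_fst.comp continuous_snd))).add
      ((continuous_klSum_left h₃0).comp (continuous_snd.comp continuous_snd))
  have hpos : ∀ q ∈ K \ V, 0 < F q := by
    rintro ⟨q₁, q₂, q₃⟩ ⟨⟨hq₁, hq₂, hq₃⟩, hqV⟩
    have n₁ := klSum_nonneg hq₁ h₁ h₁0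
    have n₂ := klSum_nonneg hq₂ h₂ h₂0
    have n₃ := klSum_nonneg hq₃ h₃ h₃0
    by_contra! hle
    have hle' : klSum q₁ m₁ + klSum q₂ m₂ + klSum q₃ m₃ ≤ 0 := hle
    obtain rfl := eq_of_klSum_eq_zero hq₁ h₁ h₁0 (by linarith)
    obtain rfl := eq_of_klSum_eq_zero hq₂ h₂ h₂0 (by linarith)
    obtain rfl := eq_of_klSum_eq_zero hq₃ h₃ h₃0 (by linarith)
    exact hqV hmV
  obtain ⟨c, hc, hcF⟩ := hK.exists_forall_le' hF.continuousOn hpos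
  exact ⟨c, hc, fun q₁ q₂ q₃ hq₁ hq₂ hq₃ hq =>
    hcF (q₁, q₂, q₃) ⟨⟨hq₁, hq₂, hq₃⟩, fun hV => hq (hVU hV)⟩⟩

lemma exists_pos_le_KL_add {m₁ m₂ m₃ : Y → ℝ}
    (h₁ : IsPmf m₁) (h₂ : IsPmf m₂) (h₃ : IsPmf m₃)
    (h₁0 : ∀ y, 0 < m₁ y) (h₂0 : ∀ y, 0 < m₂ y) (h₃0 : ∀ y, 0 < m₃ y)
    (hlt : KL m₁ m₂ < KL m₃ m₂) :
    ∃ c : ℝ, 0 < c ∧ ∀ q₁ q₂ q₃ : Y → ℝ, IsPmf q₁ → IsPmf q₂ → IsPmf q₃ →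
      KL q₃ q₂ < KL q₁ q₂ → (c : EReal) ≤ KL q₁ m₁ + KL q₂ m₂ + KL q₃ m₃ := by
  have hU : ∀ᶠ q : (Y → ℝ) × (Y → ℝ) × (Y → ℝ) in 𝓝 (m₁, m₂, m₃),
      (∀ y, 0 < q.2.1 y) ∧ klSum q.1 q.2.1 < klSum q.2.2 q.2.1 := by
    have hsnd : Continuous fun q : (Y → ℝ) × (Y → ℝ) × (Y → ℝ) => q.2.1 := by fun_prop
    have hthd : Continuous fun q : (Y → ℝ) × (Y → ℝ) × (Y → ℝ) => q.2.2 := by fun_prop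
    refine (eventually_all.2 fun y => ?_).and ?_
    · exact ((continuous_apply y).comp hsnd).continuousAt.eventually_const_lt (h₂0 y)
    · rw [KL_eq_klSum h₂0, KL_eq_klSum h₂0, EReal.coe_lt_coe_iff] at hlt
      exact (continuousAt_fst.klSum hsnd.continuousAt h₁0 h₂0).eventually_lt
        (hthd.continuousAt.klSum hsnd.continuousAt h₃0 h₂0) hlt
  obtain ⟨c, hc, hcq⟩ := exists_pos_le_klSum_add h₁ h₂ h₃ h₁0 h₂0 h₃0 hU
  refine ⟨c, hc, fun q₁ q₂ q₃ hq₁ hq₂ hq₃ hq => ?_⟩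
  rw [KL_eq_klSum h₁0, KL_eq_klSum h₂0, KL_eq_klSum h₃0]
  refine mod_cast hcq q₁ q₂ q₃ hq₁ hq₂ hq₃ ?_
  rintro ⟨hq₂0, hlt'⟩
  rw [KL_eq_klSum hq₂0, KL_eq_klSum hq₂0, EReal.coe_lt_coe_iff] at hq
  exact lt_asymm hq hlt'

end

/-- positivity of the exponent α8 under the clustering
condition. The clustering condition states that the KL divergence between any
two distributions within the same cluster (outlying cluster `{μ i}_{i∈S}` or
typical cluster `{π j}_{j∈T}`) is strictly less than the KL divergence, in
either direction, between any two distributions in different clusters. Under it,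
the stated infimum is strictly positive. -/
theorem alpha8_pos {Y : Type*} [Fintype Y] [Nonempty Y] {ι κ : Type*}
    (S : Finset ι) (hS : S.Nonempty) (T : Finset κ) (hT : T.Nonempty)
    (μ : ι → Y → ℝ) (π : κ → Y → ℝ)
    (hμ : ∀ i ∈ S, IsPmf (μ i)) (hμf : ∀ i ∈ S, ∀ y, 0 < μ i y)
    (hπ : ∀ j ∈ T, IsPmf (π j)) (hπf : ∀ j ∈ T, ∀ y, 0 < π j y)
    (hclusterμ : ∀ i ∈ S, ∀ i' ∈ S, ∀ i'' ∈ S, ∀ j ∈ T,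
      KL (μ i) (μ i') < KL (μ i'') (π j) ∧ KL (μ i) (μ i') < KL (π j) (μ i''))
    (hclusterπ : ∀ j ∈ T, ∀ j' ∈ T, ∀ i ∈ S, ∀ j'' ∈ T,
      KL (π j) (π j') < KL (μ i) (π j'') ∧ KL (π j) (π j') < KL (π j'') (μ i)) :
    0 < sInf {r : EReal | ∃ i1 ∈ S, ∃ i2 ∈ S, ∃ j ∈ T, ∃ q1 q2 q3 : Y → ℝ,
      IsPmf q1 ∧ IsPmf q2 ∧ IsPmf q3 ∧
      KL q3 q2 < KL q1 q2 ∧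
      r = KL q1 (μ i1) + KL q2 (μ i2) + KL q3 (π j)} := by
  have hev : ∀ᶠ c : ℝ in 𝓝[>] 0, ∀ i1 ∈ S, ∀ i2 ∈ S, ∀ j ∈ T, ∀ q1 q2 q3 : Y → ℝ,
      IsPmf q1 → IsPmf q2 → IsPmf q3 → KL q3 q2 < KL q1 q2 →
      (c : EReal) ≤ KL q1 (μ i1) + KL q2 (μ i2) + KL q3 (π j) := by
    refine (Finset.eventually_all S).2 fun i1 hi1 => (Finset.eventually_all S).2 fun i2 hi2 =>
      (Finset.eventually_all T).2 fun j hj => ?_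
    obtain ⟨c, hc, hcq⟩ := exists_pos_le_KL_add (hμ i1 hi1) (hμ i2 hi2) (hπ j hj)
      (hμf i1 hi1) (hμf i2 hi2) (hπf j hj) (hclusterμ i1 hi1 i2 hi2 i2 hi2 j hj).2
    filter_upwards [Ioo_mem_nhdsGT hc] with d hd q1 q2 q3 hq1 hq2 hq3 hq
    exact (EReal.coe_le_coe_iff.2 hd.2.le).trans (hcq q1 q2 q3 hq1 hq2 hq3 hq)
  obtain ⟨c, hc, hc0⟩ := (hev.and self_mem_nhdsWithin).exists
  refine lt_of_lt_of_le (EReal.coe_pos.2 hc0) (le_sInf ?_)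
  rintro r ⟨i1, hi1, i2, hi2, j, hj, q1, q2, q3, hq1, hq2, hq3, hq, rfl⟩
  exact hc i1 hi1 i2 hi2 j hj q1 q2 q3 hq1 hq2 hq3 hq
end
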